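/- arXiv:math/0611528 — 3 statements merged into one kernel-verified Lean document; each statement's English description precedes it below -/
import Mathlib

section
/- Let A be a Q-algebra over a base Q-algebra B, F an A-module, D: A → F a B-derivation, and γ: F → F ⊗_A F a D-connection (a B-linear map with γ(am) = D(a)⊗m + a·γ(m)). Define ∇ on R_+(F) = ⊕_{n≥1} R^n(F) by ∇(m_1⋯m_n) = Σ_{i=1}^n m_1⋯m_{i-1} γ(m_i) m_{i+1}⋯m_n. Then ∇ is a well-defined B-linear map R^n(F) → R^{n+1}(F) for each n, and satisfies ∇(aω) = D(a)ω + a∇(ω) for all a ∈ A and ω ∈ R_+(F). -/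
open scoped TensorProduct

noncomputable section

variable (A : Type) [CommRing A]
variable (F : Type) [AddCommGroup F] [Module A F]

/-- `n`-fold tensor power `T^n(F)`. -/
abbrev TPow (n : ℕ) := PiTensorProduct A (fun _ : Fin n => F)

/-- The submodule of symmetry relations. -/
def symRel (n : ℕ) : Submodule A (TPow A F n) :=
  Submodule.span A
    {x | ∃ (m : Fin n → F) (e : Equiv.Perm (Fin n)),
      x = PiTensorProduct.tprod A m - PiTensorProduct.tprod A (m ∘ e)}

/-- Symmetric power `S^n(F)`. -/
abbrev SymPow (n : ℕ) := TPow A F n ⧸ symRel A F n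

/-- Class of the word `m₀ ⋯ m_{n-1}` in `S^n(F)`. -/
def mkS {n : ℕ} (m : Fin n → F) : SymPow A F n :=
  Submodule.Quotient.mk (PiTensorProduct.tprod A m)

/-- Class of a list of elements of `F` in the symmetric power. -/
def mkSL (l : List F) : SymPow A F l.length := mkS A F l.get

/-- `RPow A F n` is `R^{n+1}(F) = S^n(F) ⊗_A F`. -/
abbrev RPow (n : ℕ) := SymPow A F n ⊗[A] F

/-- Class of the word `m₀ ⋯ m_n` in `R^{n+1}(F) = S^n(F) ⊗ F`. -/
def mkR {n : ℕ} (m : Fin (n + 1) → F) : RPow A F n :=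
  mkS A F (fun i : Fin n => m i.castSucc) ⊗ₜ[A] m (Fin.last n)

/-- The `i`-th "rotation" of the word `m` appearing in the definition of the
switch operator: `m_n m_{n-1} ⋯ m_{n-i+1} m_0 m_1 ⋯ m_{n-i}` (0-indexed). -/
def rot {n : ℕ} (m : Fin (n + 1) → F) (i : ℕ) : Fin (n + 1) → F := fun j =>
  if j.val < i then m ⟨n - j.val, by have := j.isLt; omega⟩
  else m ⟨j.val - i, by have := j.isLt; omega⟩

/-- `σ` is the switch operator on `R^{n+1}(F)`:
`σ(m_0⋯m_n) = ∑_{i=1}^{n} m_n m_{n-1}⋯m_{n-i+1} m_0 m_1 ⋯ m_{n-i}`. -/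
def IsSwitch (n : ℕ) (σ : RPow A F n →ₗ[A] RPow A F n) : Prop :=
  ∀ m : Fin (n + 1) → F,
    σ (mkR A F m) = ∑ i ∈ Finset.Icc 1 n, mkR A F (rot F m i)

/-- `K^{n+1}(F) = σ*(R^{n+1}(F))`, described by its generators `σ*(m_0⋯m_n)`. -/
def KSub (n : ℕ) : Submodule A (RPow A F n) :=
  Submodule.span A
    {x | ∃ m : Fin (n + 1) → F,
      x = mkR A F m + ∑ i ∈ Finset.Icc 1 n, mkR A F (rot F m i)}

/-- `K²(F) ⊆ T²(F) = F ⊗ F`: the kernel of `T²(F) → Λ²(F)`, i.e. the image of `1 + σ`. -/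
def K2Sub : Submodule A (F ⊗[A] F) :=
  Submodule.span A {x | ∃ u v : F, x = u ⊗ₜ[A] v + v ⊗ₜ[A] u}

/-- The word `m₀ ⋯ m_{p-1} u m'₀ ⋯ m'_{q-1}`. -/
def joinWord {p q : ℕ} (m : Fin p → F) (u : F) (m' : Fin q → F) :
    Fin (p + q + 1) → F := fun j =>
  if h : j.val < p then m ⟨j.val, h⟩
  else if _h2 : j.val < p + 1 then u
  else m' ⟨j.val - (p + 1), by have := j.isLt; omega⟩

/-- The concatenated word `m₀ ⋯ m_{p-1} m'₀ ⋯ m'_{q-1}`. -/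
def appendWord {p q : ℕ} (m : Fin p → F) (m' : Fin q → F) : Fin (p + q) → F := fun j =>
  if h : j.val < p then m ⟨j.val, h⟩
  else m' ⟨j.val - p, by have := j.isLt; omega⟩

/-- `mul` is the multiplication `R^{p+1}(F) × R^{q+1}(F) → R^{p+q+2}(F)` of the graded
algebra `R(F)`, recorded with values in `∏ₖ R^{k+1}(F)`:
`(s ⊗ u)·(s' ⊗ v) = (s u s') ⊗ v`. -/
def IsMulR (mul : ∀ p q, RPow A F p →ₗ[A] RPow A F q →ₗ[A] ∀ k, RPow A F k) : Prop :=
  ∀ (p q : ℕ) (m : Fin p → F) (u : F) (m' : Fin q → F) (v : F),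
    mul p q (mkS A F m ⊗ₜ[A] u) (mkS A F m' ⊗ₜ[A] v)
      = Pi.single (p + q + 1) (mkS A F (joinWord F m u m') ⊗ₜ[A] v)

/-- `mul` is the multiplication `S^p(F) × S^q(F) → S^{p+q}(F)` of the symmetric algebra,
recorded with values in `∏ₖ S^k(F)`. -/
def IsMulS (mul : ∀ p q, SymPow A F p →ₗ[A] SymPow A F q →ₗ[A] ∀ k, SymPow A F k) : Prop :=
  ∀ (p q : ℕ) (m : Fin p → F) (m' : Fin q → F),
    mul p q (mkS A F m) (mkS A F m') = Pi.single (p + q) (mkS A F (appendWord F m m'))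

/-- `π` is the family of natural maps `R^{n+1}(F) = S^n(F) ⊗ F → S^{n+1}(F)`. -/
def IsPi (π : ∀ n, RPow A F n →ₗ[A] SymPow A F (n + 1)) : Prop :=
  ∀ (n : ℕ) (m : Fin n → F) (v : F),
    π n (mkS A F m ⊗ₜ[A] v) = mkS A F (Fin.snoc m v)

/-- `T = (T₀, T₁, …)` is a (full) extended `D`-connection:  `T₀ = id_F` (under
`F ≅ R¹(F)`), and `T_i(am) = a T_i(m) + ∑_{j=1}^i (1/j) T_{j-1}(D a) T_{i-j}(m)`. -/
def IsExtConn [Algebra ℚ A] (D : A → F)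
    (mul : ∀ p q, RPow A F p →ₗ[A] RPow A F q →ₗ[A] ∀ k, RPow A F k)
    (T : ∀ i, F →+ RPow A F i) : Prop :=
  (∀ m : F, T 0 m = mkS A F (fun i : Fin 0 => i.elim0) ⊗ₜ[A] m) ∧
  ∀ (i : ℕ), 1 ≤ i → ∀ (a : A) (m : F),
    Pi.single i (T i (a • m))
      = Pi.single i (a • T i m)
        + ∑ j ∈ Finset.Icc 1 i,
            algebraMap ℚ A (1 / (j : ℚ)) •
              mul (j - 1) (i - j) (T (j - 1) (D a)) (T (i - j) m)

/-- `T = (T₀, …, T_N)` is an extended `D`-connection up to order `N`. -/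
def IsExtConnTo [Algebra ℚ A] (D : A → F)
    (mul : ∀ p q, RPow A F p →ₗ[A] RPow A F q →ₗ[A] ∀ k, RPow A F k)
    (N : ℕ) (T : ∀ i, F →+ RPow A F i) : Prop :=
  (∀ m : F, T 0 m = mkS A F (fun i : Fin 0 => i.elim0) ⊗ₜ[A] m) ∧
  ∀ (i : ℕ), 1 ≤ i → i ≤ N → ∀ (a : A) (m : F),
    Pi.single i (T i (a • m))
      = Pi.single i (a • T i m)
        + ∑ j ∈ Finset.Icc 1 i,
            algebraMap ℚ A (1 / (j : ℚ)) •
              mul (j - 1) (i - j) (T (j - 1) (D a)) (T (i - j) m)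

/-- The wedge map `F ⊗_A F →  Λ(F)`, `u ⊗ v ↦ u ∧ v`; an element of `F ⊗ F` maps to
zero in `Λ²(F)` iff its image under this map is zero. -/
def wedgeMap : F ⊗[A] F →ₗ[A] ExteriorAlgebra A F :=
  TensorProduct.lift
    ((LinearMap.mul A (ExteriorAlgebra A F)).compl₁₂ (ExteriorAlgebra.ι A) (ExteriorAlgebra.ι A))


/-- The word obtained from `m₀ ⋯ m_n` by replacing the letter `m_i` by the two
letters `u v`. -/
def insWord {n : ℕ} (m : Fin (n + 1) → F) (i : Fin (n + 1)) (u v : F) :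
    Fin (n + 2) → F := fun j =>
  if _h1 : j.val < i.val then m ⟨j.val, by have := i.isLt; omega⟩
  else if j.val = i.val then u
  else if j.val = i.val + 1 then v
  else m ⟨j.val - 1, by have := j.isLt; omega⟩

/-- `mulL` is left multiplication `F × R^{k+1}(F) → R^{k+2}(F)`, `u · (s ⊗ v) = (u s) ⊗ v`,
where `F ≅ R¹(F)`. -/
def IsMulL (mulL : ∀ k, F →ₗ[A] RPow A F k →ₗ[A] RPow A F (k + 1)) : Prop :=
  ∀ (k : ℕ) (u : F) (m : Fin k → F) (v : F),
    mulL k u (mkS A F m ⊗ₜ[A] v) = mkS A F (Fin.cons u m) ⊗ₜ[A] v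

/-- The extension of `M` by `N` twisted by a derivation `D : A → F` and a pairing
`μ : F → M → N`: the group `M × N` with scalar action `a • (x, y) = (a x, D(a) x + a y)`.
Operators `∇ : M → N` with `∇(a x) = D(a) x + a ∇(x)` are its `A`-linear sections. -/
@[ext]
structure TwistedExt {A F B M N : Type} [CommRing A] [AddCommGroup F] [Module A F]
    [CommRing B] [Algebra B A] [Module B F] [AddCommGroup M] [Module A M]
    [AddCommGroup N] [Module A N]
    (D : Derivation B A F) (μ : F →ₗ[A] M →ₗ[A] N) where
  /-- The component in the quotient `M`. -/
  base : M
  /-- The component in the submodule `N`. -/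
  fiber : N

namespace TwistedExt

variable {A F B M N : Type} [CommRing A] [AddCommGroup F] [Module A F]
  [CommRing B] [Algebra B A] [Module B F] [AddCommGroup M] [Module A M]
  [AddCommGroup N] [Module A N]
  (D : Derivation B A F) (μ : F →ₗ[A] M →ₗ[A] N)

/-- The underlying pair of an element of a twisted extension. -/
def equivProd : TwistedExt D μ ≃ M × N where
  toFun x := (x.base, x.fiber)
  invFun x := ⟨x.1, x.2⟩
  left_inv _ := rfl
  right_inv _ := rfl

instance : AddCommGroup (TwistedExt D μ) := (equivProd D μ).addCommGroup

instance : SMul A (TwistedExt D μ) where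
  smul a x := ⟨a • x.base, μ (D a) x.base + a • x.fiber⟩

variable {D μ}

@[simp] lemma zero_base : (0 : TwistedExt D μ).base = 0 := rfl
@[simp] lemma zero_fiber : (0 : TwistedExt D μ).fiber = 0 := rfl
@[simp] lemma add_base (x y : TwistedExt D μ) : (x + y).base = x.base + y.base := rfl
@[simp] lemma add_fiber (x y : TwistedExt D μ) : (x + y).fiber = x.fiber + y.fiber := rfl
@[simp] lemma smul_base (a : A) (x : TwistedExt D μ) : (a • x).base = a • x.base := rfl
@[simp] lemma smul_fiber (a : A) (x : TwistedExt D μ) :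
    (a • x).fiber = μ (D a) x.base + a • x.fiber := rfl

instance : Module A (TwistedExt D μ) where
  one_smul x := by ext <;> simp
  mul_smul a b x := by
    ext
    · simp [mul_smul]
    · simp only [smul_fiber, smul_base, Derivation.leibniz, map_add, map_smul,
        LinearMap.add_apply, LinearMap.smul_apply, smul_add, mul_smul]
      abel
  smul_zero a := by ext <;> simp
  smul_add a x y := by
    ext
    · simp
    · simp only [smul_fiber, add_fiber, add_base, map_add, smul_add]
      abel
  add_smul a b x := by
    ext
    · simp [add_smul]
    · simp only [smul_fiber, add_fiber, map_add, LinearMap.add_apply, add_smul]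
      abel
  zero_smul x := by ext <;> simp

/-- The projection of a twisted extension to its quotient. -/
def baseHom : TwistedExt D μ →ₗ[A] M where
  toFun := base
  map_add' _ _ := rfl
  map_smul' _ _ := rfl

/-- The projection of a twisted extension to its second component. -/
def fiberHom : TwistedExt D μ →+ N where
  toFun := fiber
  map_zero' := rfl
  map_add' _ _ := rfl

end TwistedExt

section Leibniz

variable {A F B M N ι : Type} [CommRing A] [AddCommGroup F] [Module A F]
  [CommRing B] [Algebra B A] [Module B F] [AddCommGroup M] [Module A M]
  [AddCommGroup N] [Module A N] [DecidableEq ι]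

/-- The map `u ⊗ v ↦ μ(u, P(m₁, …, v, …, m_n))`, with `v` in position `i`. -/
def replaceLetter (μ : F →ₗ[A] M →ₗ[A] N) (P : MultilinearMap A (fun _ : ι => F) M)
    (m : ι → F) (i : ι) : F ⊗[A] F →ₗ[A] N :=
  TensorProduct.lift (μ.compl₂ (P.toLinearMap m i))

@[simp] lemma replaceLetter_tmul (μ : F →ₗ[A] M →ₗ[A] N)
    (P : MultilinearMap A (fun _ : ι => F) M) (m : ι → F) (i : ι) (u v : F) :
    replaceLetter μ P m i (u ⊗ₜ[A] v) = μ u (P (Function.update m i v)) := rfl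

lemma replaceLetter_update_self (μ : F →ₗ[A] M →ₗ[A] N)
    (P : MultilinearMap A (fun _ : ι => F) M) (m : ι → F) (i : ι) (x : F) :
    replaceLetter μ P (Function.update m i x) i = replaceLetter μ P m i := by
  ext u v
  simp

lemma replaceLetter_update_add (μ : F →ₗ[A] M →ₗ[A] N)
    (P : MultilinearMap A (fun _ : ι => F) M) (m : ι → F) {i j : ι} (hij : i ≠ j) (x y : F) :
    replaceLetter μ P (Function.update m j (x + y)) i =
      replaceLetter μ P (Function.update m j x) i +
        replaceLetter μ P (Function.update m j y) i := by
  ext u v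
  simp [Function.update_comm hij.symm]

lemma replaceLetter_update_smul (μ : F →ₗ[A] M →ₗ[A] N)
    (P : MultilinearMap A (fun _ : ι => F) M) (m : ι → F) {i j : ι} (hij : i ≠ j)
    (a : A) (x : F) :
    replaceLetter μ P (Function.update m j (a • x)) i =
      a • replaceLetter μ P (Function.update m j x) i := by
  ext u v
  simp [Function.update_comm hij.symm]

lemma replaceLetter_comp_perm (μ : F →ₗ[A] M →ₗ[A] N)
    (P : MultilinearMap A (fun _ : ι => F) M) (e : Equiv.Perm ι)
    (he : ∀ m, P (m ∘ e) = P m) (m : ι → F) (i : ι) :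
    replaceLetter μ P (m ∘ e) i = replaceLetter μ P m (e i) := by
  ext u v
  have h : Function.update (m ∘ e) i v = Function.update m (e i) v ∘ e :=
    (Function.update_comp_eq_of_injective m e.injective i v).symm
  simp [h, he]

variable [Fintype ι]

/-- The Leibniz sum `∑ᵢ P(m₁, …, γ(m_i), …, m_n)` attached to a multilinear map `P`. -/
def leibnizSum (μ : F →ₗ[A] M →ₗ[A] N) (γ : F →+ F ⊗[A] F)
    (P : MultilinearMap A (fun _ : ι => F) M) (m : ι → F) : N :=
  ∑ i, replaceLetter μ P m i (γ (m i))

lemma leibnizSum_update_add (μ : F →ₗ[A] M →ₗ[A] N) (γ : F →+ F ⊗[A] F)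
    (P : MultilinearMap A (fun _ : ι => F) M) (m : ι → F) (j : ι) (x y : F) :
    leibnizSum μ γ P (Function.update m j (x + y)) =
      leibnizSum μ γ P (Function.update m j x) + leibnizSum μ γ P (Function.update m j y) := by
  simp only [leibnizSum, ← Finset.sum_add_distrib]
  refine Finset.sum_congr rfl fun i _ => ?_
  rcases eq_or_ne i j with rfl | hij
  · simp [replaceLetter_update_self]
  · simp [replaceLetter_update_add μ P m hij, hij]

lemma leibnizSum_update_smul (D : Derivation B A F) (μ : F →ₗ[A] M →ₗ[A] N)
    (γ : F →+ F ⊗[A] F) (hγ : ∀ (a : A) (m : F), γ (a • m) = D a ⊗ₜ[A] m + a • γ m)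
    (P : MultilinearMap A (fun _ : ι => F) M) (m : ι → F) (j : ι) (a : A) (x : F) :
    leibnizSum μ γ P (Function.update m j (a • x)) =
      μ (D a) (P (Function.update m j x)) + a • leibnizSum μ γ P (Function.update m j x) := by
  simp only [leibnizSum, ← Finset.add_sum_erase _ _ (Finset.mem_univ j), smul_add,
    Finset.smul_sum, ← add_assoc]
  congr 1
  · simp [replaceLetter_update_self, hγ]
  · refine Finset.sum_congr rfl fun i hi => ?_
    have hij := Finset.ne_of_mem_erase hi
    simp [replaceLetter_update_smul μ P m hij, hij]

lemma leibnizSum_comp_perm (μ : F →ₗ[A] M →ₗ[A] N) (γ : F →+ F ⊗[A] F)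
    (P : MultilinearMap A (fun _ : ι => F) M) (e : Equiv.Perm ι)
    (he : ∀ m, P (m ∘ e) = P m) (m : ι → F) :
    leibnizSum μ γ P (m ∘ e) = leibnizSum μ γ P m := by
  simp only [leibnizSum, replaceLetter_comp_perm μ P e he, Function.comp_apply]
  exact Equiv.sum_comp e fun i => replaceLetter μ P m i (γ (m i))

/-- A multilinear map together with its Leibniz sum is multilinear into the twisted
extension. -/
def leibnizMultilinear (D : Derivation B A F) (μ : F →ₗ[A] M →ₗ[A] N)
    (γ : F →+ F ⊗[A] F) (hγ : ∀ (a : A) (m : F), γ (a • m) = D a ⊗ₜ[A] m + a • γ m)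
    (P : MultilinearMap A (fun _ : ι => F) M) :
    MultilinearMap A (fun _ : ι => F) (TwistedExt D μ) :=
  MultilinearMap.mk' (fun m => ⟨P m, leibnizSum μ γ P m⟩)
    (fun m j x y => TwistedExt.ext (P.map_update_add m j x y)
      (leibnizSum_update_add μ γ P m j x y))
    (fun m j a x => TwistedExt.ext (P.map_update_smul m j a x)
      (leibnizSum_update_smul D μ γ hγ P m j a x))

end Leibniz

section Letters

variable {F : Type}

/-- A permutation of the first `n` letters extends to all `n + 1` letters. -/
lemma exists_perm_snoc_comp {n : ℕ} (e : Equiv.Perm (Fin n)) :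
    ∃ e' : Equiv.Perm (Fin (n + 1)), ∀ (m : Fin n → F) (v : F),
      Fin.snoc (α := fun _ => F) (m ∘ e) v = Fin.snoc (α := fun _ => F) m v ∘ e' := by
  refine ⟨finSuccEquivLast.symm.permCongr e.optionCongr, fun m v => funext fun i => ?_⟩
  induction i using Fin.lastCases <;> simp

lemma insWord_castSucc {n : ℕ} (m : Fin (n + 1) → F) (i : Fin (n + 1)) (u v : F) :
    (fun j : Fin (n + 1) => insWord F m i u v j.castSucc) =
      i.insertNth (α := fun _ => F) u (Fin.init (Function.update m i v)) := by
  refine Fin.eq_insertNth_iff.2 ⟨by simp [insWord], funext fun j => ?_⟩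
  rcases lt_or_ge j.castSucc i with h | h
  · have h' : j.val < i.val := h
    simp [insWord, Fin.removeNth, Fin.init, Fin.succAbove_of_castSucc_lt _ _ h, h', h.ne]
    rfl
  · have h' : i.val ≤ j.val := h
    rcases h'.eq_or_lt with h'' | h''
    · have hi : i = j.castSucc := Fin.ext h''
      simp [insWord, Fin.removeNth, Fin.init, hi]
    · have hi : j.castSucc ≠ i := fun hh => by simp [← hh] at h''
      simp [insWord, Fin.removeNth, Fin.init, Fin.succAbove_of_le_castSucc _ _ h, hi,
        show ¬ j.val + 1 < i.val by omega, show j.val + 1 ≠ i.val by omega, h''.ne']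
      rfl

lemma insWord_last {n : ℕ} (m : Fin (n + 1) → F) (i : Fin (n + 1)) (u v : F) :
    insWord F m i u v (Fin.last (n + 1)) = Function.update m i v (Fin.last n) := by
  rcases eq_or_ne i (Fin.last n) with rfl | hi
  · simp [insWord]
  · have h : i.val < n := Fin.val_lt_last hi
    simp [insWord, hi.symm, h.ne', show ¬ n + 1 < i.val by omega, show n + 1 ≠ i.val by omega]
    rfl

end Letters

section Words

variable {A F E : Type} [CommRing A] [AddCommGroup F] [Module A F]
  [AddCommGroup E] [Module A E]

lemma mkS_comp_perm {n : ℕ} (m : Fin n → F) (e : Equiv.Perm (Fin n)) :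
    mkS A F (m ∘ e) = mkS A F m :=
  Eq.symm <| (Submodule.Quotient.eq (symRel A F n)).2 <| Submodule.subset_span ⟨m, e, rfl⟩

/-- The class of a word in `R^{n+1}(F)` as a multilinear map. -/
def mkRMultilinear (A F : Type) [CommRing A] [AddCommGroup F] [Module A F] (n : ℕ) :
    MultilinearMap A (fun _ : Fin (n + 1) => F) (RPow A F n) :=
  MultilinearMap.uncurryRight (M := fun _ : Fin (n + 1) => F)
    (((TensorProduct.mk A (SymPow A F n) F).comp (symRel A F n).mkQ).compMultilinearMap
      (PiTensorProduct.tprod A))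

@[simp] lemma mkRMultilinear_apply {n : ℕ} (m : Fin (n + 1) → F) :
    mkRMultilinear A F n m = mkR A F m := rfl

/-- Universal property of `R^{n+1}(F)`: a multilinear map symmetric in all but its last
argument factors through `R^{n+1}(F)`. -/
lemma exists_linearMap_mkR {n : ℕ} (Q : MultilinearMap A (fun _ : Fin (n + 1) => F) E)
    (hQ : ∀ (m : Fin n → F) (v : F) (e : Equiv.Perm (Fin n)),
      Q (Fin.snoc (α := fun _ => F) (m ∘ e) v) = Q (Fin.snoc (α := fun _ => F) m v)) :
    ∃ f : RPow A F n →ₗ[A] E, ∀ m, f (mkR A F m) = Q m := by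
  have hker : symRel A F n ≤ LinearMap.ker
      (PiTensorProduct.lift (MultilinearMap.curryRight (M := fun _ : Fin (n + 1) => F) Q)) := by
    refine Submodule.span_le.2 ?_
    rintro _ ⟨m, e, rfl⟩
    refine LinearMap.mem_ker.2 ?_
    ext v
    simp [hQ]
  refine ⟨TensorProduct.lift ((symRel A F n).liftQ _ hker), fun m => ?_⟩
  change PiTensorProduct.lift (MultilinearMap.curryRight (M := fun _ : Fin (n + 1) => F) Q)
    (PiTensorProduct.tprod A (Fin.init m)) (m (Fin.last n)) = Q m
  simp

/-- Linear maps on `R^{n+1}(F)` agreeing on words are equal. -/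
lemma linearMap_ext_mkR {n : ℕ} {f g : RPow A F n →ₗ[A] E}
    (h : ∀ m, f (mkR A F m) = g (mkR A F m)) : f = g := by
  refine TensorProduct.ext (Submodule.linearMap_qext _ (PiTensorProduct.ext ?_))
  ext m v
  simpa [mkR, mkS] using h (Fin.snoc (α := fun _ => F) m v)

lemma mkR_snoc_comp_perm {n : ℕ} (m : Fin n → F) (v : F) (e : Equiv.Perm (Fin n)) :
    mkR A F (Fin.snoc (α := fun _ => F) (m ∘ e) v) =
      mkR A F (Fin.snoc (α := fun _ => F) m v) := by
  simp only [mkR, Fin.snoc_castSucc, Fin.snoc_last]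
  exact congrArg (· ⊗ₜ[A] v) (mkS_comp_perm m e)

/-- In `R^{n+2}(F)`, the letter `u` of `m₀ ⋯ u v ⋯ m_n` may be moved to the front. -/
lemma mkR_insWord {n : ℕ} (m : Fin (n + 1) → F) (i : Fin (n + 1)) (u v : F) :
    mkR A F (insWord F m i u v) =
      mkS A F (Fin.cons u (Fin.init (Function.update m i v))) ⊗ₜ[A]
        Function.update m i v (Fin.last n) := by
  rw [mkR, insWord_castSucc, insWord_last, ← Fin.cons_comp_cycleRange, mkS_comp_perm]

end Words

/-- Given a `D`-connection `γ`, the operator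
`∇(m₁⋯m_n) = ∑ᵢ m₁ ⋯ m_{i-1} γ(m_i) m_{i+1} ⋯ m_n` is a well-defined `B`-linear map
`R^n(F) → R^{n+1}(F)` satisfying `∇(aω) = D(a)ω + a∇(ω)`. -/
theorem nabla_wellDefined (B : Type) [CommRing B] [Algebra B A]
    [Module B F] [IsScalarTower B A F]
    (D : Derivation B A F)
    (γ : F →+ F ⊗[A] F)
    (hγ : ∀ (a : A) (m : F), γ (a • m) = D a ⊗ₜ[A] m + a • γ m)
    (ins : ∀ (k : ℕ) (m : Fin (k + 1) → F) (i : Fin (k + 1)),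
      F ⊗[A] F →ₗ[A] RPow A F (k + 1))
    (hins : ∀ k m i u v, ins k m i (u ⊗ₜ[A] v) = mkR A F (insWord F m i u v))
    (mulL : ∀ k, F →ₗ[A] RPow A F k →ₗ[A] RPow A F (k + 1))
    (hmulL : IsMulL A F mulL) :
    ∃ Del : ∀ k, RPow A F k →+ RPow A F (k + 1),
      (∀ (k : ℕ) (m : Fin (k + 1) → F),
        Del k (mkR A F m) = ∑ i : Fin (k + 1), ins k m i (γ (m i)))
      ∧ (∀ (k : ℕ) (a : A) (ω : RPow A F k),
          Del k (a • ω) = mulL k (D a) ω + a • Del k ω)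
      ∧ (∀ (k : ℕ) (b : B) (ω : RPow A F k),
          Del k (algebraMap B A b • ω) = algebraMap B A b • Del k ω) := by
  have hins' (k : ℕ) (m : Fin (k + 1) → F) (i : Fin (k + 1)) :
      ins k m i = replaceLetter (mulL k) (mkRMultilinear A F k) m i := by
    refine TensorProduct.ext' fun u v => ?_
    rw [hins, replaceLetter_tmul, mkRMultilinear_apply, mkR_insWord]
    exact (hmulL k u _ _).symm
  have hlift (k : ℕ) := exists_linearMap_mkR
    (leibnizMultilinear D (mulL k) γ hγ (mkRMultilinear A F k)) fun m v e => by
      obtain ⟨e', he'⟩ := exists_perm_snoc_comp (F := F) e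
      have hinv (w : Fin (k + 1) → F) :
          mkRMultilinear A F k (w ∘ e') = mkRMultilinear A F k w := by
        rw [← Fin.snoc_init_self w, ← he']
        exact mkR_snoc_comp_perm _ _ _
      rw [he']
      exact TwistedExt.ext (hinv _) (leibnizSum_comp_perm _ _ _ e' hinv _)
  choose f hf using hlift
  have hbase (k : ℕ) (ω : RPow A F k) : (f k ω).base = ω := by
    have h : TwistedExt.baseHom ∘ₗ f k = LinearMap.id :=
      linearMap_ext_mkR fun m => congrArg TwistedExt.base (hf k m)
    exact LinearMap.congr_fun h ω
  have hleibniz (k : ℕ) (a : A) (ω : RPow A F k) :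
      (f k (a • ω)).fiber = mulL k (D a) ω + a • (f k ω).fiber := by
    rw [map_smul, TwistedExt.smul_fiber, hbase]
  refine ⟨fun k => TwistedExt.fiberHom.comp (f k).toAddMonoidHom, fun k m => ?_, hleibniz,
    fun k b ω => ?_⟩
  · simp only [hins']
    exact congrArg TwistedExt.fiber (hf k m)
  · exact (hleibniz k _ ω).trans (by simp; rfl)

end
end

section
/- Let F be a free A-module with basis e_1,…,e_n and D = Σ_i D_i e_i a B-derivation A → F, where D_i are B-derivations of A. Then D is integrable (i.e., there exists a flat D-connection γ: F → F⊗F, meaning the composite of γ∘D with the projection T^2(F) → Λ^2(F) vanishes) if and only if the family {D_1,…,D_n} is involutive, i.e., there exist elements b^{j,i}_ℓ ∈ A with [D_j, D_i] = Σ_ℓ b^{j,i}_ℓ D_ℓ for all i ≠ j. -/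
open scoped TensorProduct

noncomputable section

variable (A : Type) [CommRing A]
variable (F : Type) [AddCommGroup F] [Module A F]

/-- The `(i, j)` coordinate of an element of `Aⁿ ⊗ Aⁿ`. -/
def tensorCoord {n : ℕ} (i j : Fin n) : (Fin n → A) ⊗[A] (Fin n → A) →ₗ[A] A :=
  LinearMap.mul' A A ∘ₗ TensorProduct.map (LinearMap.proj i) (LinearMap.proj j)

@[simp]
theorem tensorCoord_tmul {n : ℕ} (i j : Fin n) (u v : Fin n → A) :
    tensorCoord A i j (u ⊗ₜ[A] v) = u i * v j := rfl

@[simp]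
theorem wedgeMap_tmul (u v : F) :
    wedgeMap A F (u ⊗ₜ[A] v) = ExteriorAlgebra.ι A u * ExteriorAlgebra.ι A v := rfl

theorem sum_tensorCoord_smul {n : ℕ} (t : (Fin n → A) ⊗[A] (Fin n → A)) :
    ∑ p : Fin n × Fin n, tensorCoord A p.1 p.2 t •
      ((Pi.single p.1 1 : Fin n → A) ⊗ₜ[A] (Pi.single p.2 1 : Fin n → A)) = t := by
  induction t with
  | zero => simp
  | add x y hx hy => simp only [map_add, add_smul, Finset.sum_add_distrib, hx, hy]
  | tmul u v =>
    conv_rhs => rw [pi_eq_sum_univ' u, pi_eq_sum_univ' v]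
    simp only [TensorProduct.sum_tmul, TensorProduct.tmul_sum, Fintype.sum_prod_type,
      tensorCoord_tmul, TensorProduct.smul_tmul_smul]
    exact Finset.sum_comm

/-- The `2 × 2` minor in columns `i` and `j`, as a linear form on the exterior algebra. -/
def wedgeMinor {n : ℕ} (i j : Fin n) : ExteriorAlgebra A (Fin n → A) →ₗ[A] A :=
  ExteriorAlgebra.liftAlternating
    (Pi.single 2 (Matrix.detRowAlternating.compLinearMap (LinearMap.funLeft A A ![i, j])))

theorem wedgeMinor_wedgeMap {n : ℕ} (i j : Fin n) (t : (Fin n → A) ⊗[A] (Fin n → A)) :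
    wedgeMinor A i j (wedgeMap A _ t) = tensorCoord A i j t - tensorCoord A j i t := by
  induction t with
  | zero => simp
  | add x y hx hy => simp only [map_add, hx, hy]; ring
  | tmul u v =>
    have h : wedgeMap A _ (u ⊗ₜ[A] v) = ExteriorAlgebra.ιMulti A 2 ![u, v] := by
      simp [ExteriorAlgebra.ιMulti_apply]
    rw [h, wedgeMinor, ExteriorAlgebra.liftAlternating_apply_ιMulti, Pi.single_eq_same,
      AlternatingMap.compLinearMap_apply]
    exact (Matrix.det_fin_two _).trans (by simp [LinearMap.funLeft_apply])

theorem wedgeMap_eq_zero_iff {n : ℕ} (t : (Fin n → A) ⊗[A] (Fin n → A)) :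
    wedgeMap A _ t = 0 ↔ ∀ i j, i ≠ j → tensorCoord A i j t = tensorCoord A j i t := by
  constructor
  · intro h i j _
    rw [← sub_eq_zero, ← wedgeMinor_wedgeMap, h, map_zero]
  · intro h
    rw [← sum_tensorCoord_smul A t, map_sum]
    refine Finset.sum_ninvolution Prod.swap ?_ ?_ (fun _ => Finset.mem_univ _) Prod.swap_swap
    · rintro ⟨i, j⟩
      obtain rfl | hij := eq_or_ne i j
      · simp
      · simp only [map_smul, wedgeMap_tmul, Prod.swap_prod_mk, h i j hij, ← smul_add,
          ExteriorAlgebra.ι_add_mul_swap, smul_zero]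
    · rintro ⟨i, j⟩ hne heq
      obtain rfl : j = i := congrArg Prod.fst heq
      exact hne (by simp)

/-- The coordinates of `γ v` for a `D`-connection `γ`, in terms of its values on the
standard basis. -/
theorem tensorCoord_connection {n : ℕ} (D : A → Fin n → A)
    (γ : (Fin n → A) →+ ((Fin n → A) ⊗[A] (Fin n → A)))
    (hγ : ∀ (a : A) (m : Fin n → A), γ (a • m) = D a ⊗ₜ[A] m + a • γ m)
    (v : Fin n → A) (i j : Fin n) :
    tensorCoord A i j (γ v)
      = D (v j) i + ∑ ℓ, tensorCoord A i j (γ (Pi.single ℓ 1)) * v ℓ := by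
  have hv : v = ∑ ℓ, v ℓ • (Pi.single ℓ 1 : Fin n → A) := pi_eq_sum_univ' v
  conv_lhs => rw [hv]
  simp [hγ, Finset.sum_add_distrib, Pi.single_apply, mul_comm]

/-- A connection on a free module may be prescribed arbitrarily on the standard basis. -/
theorem exists_connection {B : Type} [CommRing B] [Algebra B A] {n : ℕ}
    (Dv : Fin n → Derivation B A A) (G : Fin n → (Fin n → A) ⊗[A] (Fin n → A)) :
    ∃ γ : (Fin n → A) →+ ((Fin n → A) ⊗[A] (Fin n → A)),
      (∀ (a : A) (m : Fin n → A), γ (a • m) = (fun i => Dv i a) ⊗ₜ[A] m + a • γ m) ∧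
      ∀ ℓ, γ (Pi.single ℓ 1) = G ℓ := by
  have hadd (a b : A) : (fun i => Dv i (a + b)) = (fun i => Dv i a) + fun i => Dv i b := by
    ext i; simp
  have hmul (a b : A) :
      (fun i => Dv i (a * b)) = a • (fun i => Dv i b) + b • fun i => Dv i a := by
    ext i; simp
  refine ⟨AddMonoidHom.mk' (fun m => ∑ k, ((fun i => Dv i (m k)) ⊗ₜ[A] Pi.single k 1 + m k • G k))
    fun m m' => ?_, fun a m => ?_, fun ℓ => ?_⟩
  · simp only [Pi.add_apply, hadd, TensorProduct.add_tmul, add_smul, ← Finset.sum_add_distrib]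
    exact Finset.sum_congr rfl fun _ _ => by abel
  · have hm : m = ∑ k, m k • (Pi.single k 1 : Fin n → A) := pi_eq_sum_univ' m
    conv_rhs => rw [hm]
    simp only [AddMonoidHom.mk'_apply, Pi.smul_apply, smul_eq_mul, hmul, TensorProduct.add_tmul,
      Finset.smul_sum, TensorProduct.tmul_sum, ← Finset.sum_add_distrib]
    rw [← hm]
    refine Finset.sum_congr rfl fun k _ => ?_
    simp only [TensorProduct.tmul_smul, TensorProduct.smul_tmul', smul_add, mul_smul]
    abel
  · rw [AddMonoidHom.mk'_apply, Finset.sum_eq_single ℓ]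
    · simp [← Pi.zero_def]
    · intro k _ hk
      simp [hk, ← Pi.zero_def]
    · simp

/-- For a free module `F = Aⁿ` and `D = ∑ᵢ Dᵢ eᵢ`, the derivation `D`
is integrable (there is a flat `D`-connection, i.e. one whose composite with
`T²(F) → Λ²(F)` kills `D(A)`) iff the family `{D₁, …, D_n}` is involutive. -/
theorem free_integrable_iff_involutive (B : Type) [CommRing B] [Algebra B A]
    (n : ℕ) (Dv : Fin n → Derivation B A A)
    (D : A → (Fin n → A)) (hD : ∀ (a : A) (i : Fin n), D a i = Dv i a) :
    (∃ γ : (Fin n → A) →+ ((Fin n → A) ⊗[A] (Fin n → A)),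
        (∀ (a : A) (m : Fin n → A), γ (a • m) = D a ⊗ₜ[A] m + a • γ m)
        ∧ (∀ (b : B) (m : Fin n → A),
            γ (algebraMap B A b • m) = algebraMap B A b • γ m)
        ∧ ∀ a : A, wedgeMap A (Fin n → A) (γ (D a)) = 0)
    ↔ ∃ b : Fin n → Fin n → Fin n → A,
        ∀ i j : Fin n, i ≠ j → ∀ a : A,
          Dv j (Dv i a) - Dv i (Dv j a) = ∑ ℓ, b j i ℓ * Dv ℓ a := by
  obtain rfl : D = fun a i => Dv i a := funext fun a => funext (hD a)
  constructor
  · rintro ⟨γ, hγ, -, hflat⟩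
    refine ⟨fun j i ℓ => tensorCoord A i j (γ (Pi.single ℓ 1))
      - tensorCoord A j i (γ (Pi.single ℓ 1)), fun i j hij a => ?_⟩
    have h := (wedgeMap_eq_zero_iff A _).1 (hflat a) i j hij
    simp only [tensorCoord_connection A _ γ hγ (fun i => Dv i a)] at h
    simp only [sub_mul, Finset.sum_sub_distrib]
    linear_combination -h
  · rintro ⟨b, hb⟩
    obtain ⟨γ, hγ, hG⟩ := exists_connection A Dv fun ℓ =>
      ∑ p : Fin n × Fin n, (if p.1 < p.2 then b p.2 p.1 ℓ else 0) •
        ((Pi.single p.1 1 : Fin n → A) ⊗ₜ[A] (Pi.single p.2 1 : Fin n → A))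
    have hcoord (i j ℓ : Fin n) : tensorCoord A i j (γ (Pi.single ℓ 1))
        = if i < j then b j i ℓ else 0 := by
      simp only [hG, map_sum, map_smul, tensorCoord_tmul, Fintype.sum_prod_type]
      simp [Pi.single_apply]
    refine ⟨γ, hγ, fun c m => ?_, fun a => (wedgeMap_eq_zero_iff A _).2 ?_⟩
    · rw [hγ]
      simp [← Pi.zero_def]
    · have hlt (i j : Fin n) (hij : i < j) : tensorCoord A i j (γ fun i => Dv i a)
          = tensorCoord A j i (γ fun i => Dv i a) := by
        simp only [tensorCoord_connection A _ γ hγ (fun i => Dv i a), hcoord, if_pos hij,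
          if_neg hij.not_gt, zero_mul, Finset.sum_const_zero]
        linear_combination -hb i j hij.ne a
      intro i j hij
      obtain h | h := hij.lt_or_gt
      · exact hlt i j h
      · exact (hlt j i h).symm

end
end

section
/- Let A := C[t^3, t^4, t^5] ⊂ C[t], and let ω be the A-module generated by η_1, η_2 with relations t^3 η_1 = t^4 η_2, t^4 η_1 = t^5 η_2, t^5 η_1 = t^6 η_2 (the dualizing module, with η_1 = dt/t^2, η_2 = dt/t^3). Let D: A → ω be the derivation with D(f) = f'(t)·t^2·η_1. Then the formula γ(a η_1 + b η_2) = D(a)⊗η_1 + D(b)⊗η_2 + 4t^3 a·η_2⊗η_2 + 3b·η_1⊗η_1 gives a well-defined D-connection γ: ω → ω⊗_A ω, and γ is flat (its composite with T^2(ω) → Λ^2(ω) kills D(A)); hence D is integrable even though ω is not a free A-module. -/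
open scoped TensorProduct

noncomputable section

variable (A : Type) [CommRing A]
variable (F : Type) [AddCommGroup F] [Module A F]

set_option synthInstance.maxHeartbeats 1000000
set_option maxHeartbeats 4000000

/-- The coordinate ring `ℂ[t³, t⁴, t⁵]` of the monomial space curve, as a subalgebra
of the field of rational functions (`t := X`). -/
abbrev MonCurve : Subalgebra ℂ (RatFunc ℂ) :=
  Algebra.adjoin ℂ {RatFunc.X ^ 3, RatFunc.X ^ 4, RatFunc.X ^ 5}

/-- The dualizing module `ω`, realized Rosenlicht-style as the `MonCurve`-submodule of
(coefficients of) meromorphic differentials generated by `η₁ = dt/t²` and `η₂ = dt/t³`,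
identifying `g·dt` with `g`. -/
abbrev MonOmega : Submodule MonCurve (RatFunc ℂ) :=
  Submodule.span MonCurve {RatFunc.X⁻¹ ^ 2, RatFunc.X⁻¹ ^ 3}

def eta1 : MonOmega := ⟨RatFunc.X⁻¹ ^ 2, Submodule.subset_span (Set.mem_insert _ _)⟩

def eta2 : MonOmega :=
  ⟨RatFunc.X⁻¹ ^ 3, Submodule.subset_span (Set.mem_insert_of_mem _ rfl)⟩

def tcube : MonCurve := ⟨RatFunc.X ^ 3, Algebra.subset_adjoin (Set.mem_insert _ _)⟩

def tfourth : MonCurve :=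
  ⟨RatFunc.X ^ 4, Algebra.subset_adjoin (Set.mem_insert_of_mem _ (Set.mem_insert _ _))⟩

def tfifth : MonCurve :=
  ⟨RatFunc.X ^ 5,
    Algebra.subset_adjoin (Set.mem_insert_of_mem _ (Set.mem_insert_of_mem _ rfl))⟩

section Connection

variable {R M : Type*} [CommRing R] [AddCommGroup M] [Module R M]

/-- The expression `D(a)⊗e₁ + D(b)⊗e₂ + p a·e₂⊗e₂ + q b·e₁⊗e₁`. -/
def connectionExpr (D : R →+ M) (e₁ e₂ : M) (p q : R) : R × R →+ M ⊗[R] M where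
  toFun u := D u.1 ⊗ₜ[R] e₁ + D u.2 ⊗ₜ[R] e₂ + (p * u.1) • e₂ ⊗ₜ[R] e₂ + (q * u.2) • e₁ ⊗ₜ[R] e₁
  map_zero' := by simp
  map_add' u v := by
    simp only [Prod.fst_add, Prod.snd_add, map_add, TensorProduct.add_tmul, mul_add, add_smul]
    abel

theorem connectionExpr_apply (D : R →+ M) (e₁ e₂ : M) (p q : R) (u : R × R) :
    connectionExpr D e₁ e₂ p q u =
      D u.1 ⊗ₜ[R] e₁ + D u.2 ⊗ₜ[R] e₂ + (p * u.1) • e₂ ⊗ₜ[R] e₂ + (q * u.2) • e₁ ⊗ₜ[R] e₁ :=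
  rfl

theorem connectionExpr_smul {D : R →+ M} (hD : ∀ f g : R, D (f * g) = f • D g + g • D f)
    (e₁ e₂ : M) (p q c : R) (u : R × R) :
    connectionExpr D e₁ e₂ p q (c • u) =
      D c ⊗ₜ[R] (u.1 • e₁ + u.2 • e₂) + c • connectionExpr D e₁ e₂ p q u := by
  simp only [connectionExpr_apply, Prod.smul_fst, Prod.smul_snd, smul_eq_mul, hD,
    TensorProduct.add_tmul, TensorProduct.tmul_add, TensorProduct.tmul_smul, smul_add, smul_smul,
    ← TensorProduct.smul_tmul']
  rw [show p * (c * u.1) = c * (p * u.1) by ring, show q * (c * u.2) = c * (q * u.2) by ring]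
  abel

/-- A `D`-connection on a module with two generators descends from its formula on coefficients
as soon as the formula vanishes on all relations. -/
theorem exists_connection_of_relations {D : R →+ M}
    (hD : ∀ f g : R, D (f * g) = f • D g + g • D f) {e₁ e₂ : M}
    (hspan : ∀ m : M, ∃ a b : R, a • e₁ + b • e₂ = m) (p q : R)
    (hrel : ∀ u : R × R, u.1 • e₁ + u.2 • e₂ = 0 → connectionExpr D e₁ e₂ p q u = 0) :
    ∃ γ : M →+ M ⊗[R] M,
      (∀ u : R × R, γ (u.1 • e₁ + u.2 • e₂) = connectionExpr D e₁ e₂ p q u) ∧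
      ∀ (a : R) (m : M), γ (a • m) = D a ⊗ₜ[R] m + a • γ m := by
  let π : R × R →+ M :=
    { toFun := fun u => u.1 • e₁ + u.2 • e₂
      map_zero' := by simp
      map_add' := fun u v => by simp only [Prod.fst_add, Prod.snd_add, add_smul]; abel }
  have hπ : Function.Surjective π := fun m => by
    obtain ⟨a, b, h⟩ := hspan m
    exact ⟨(a, b), h⟩
  let γ := π.liftOfSurjective hπ ⟨connectionExpr D e₁ e₂ p q, fun u hu => hrel u hu⟩
  have hγ : ∀ u, γ (π u) = connectionExpr D e₁ e₂ p q u := fun u =>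
    π.liftOfRightInverse_comp_apply _ _ ⟨connectionExpr D e₁ e₂ p q, fun u hu => hrel u hu⟩ u
  refine ⟨γ, hγ, fun a m => ?_⟩
  obtain ⟨u, rfl⟩ := hπ m
  have hsmul : a • π u = π (a • u) := by
    change a • (u.1 • e₁ + u.2 • e₂) = (a * u.1) • e₁ + (a * u.2) • e₂
    rw [smul_add, smul_smul, smul_smul]
  rw [hsmul, hγ, hγ, connectionExpr_smul hD]
  rfl

/-- The connection formula vanishes on the relations of the dualizing module of the monomial
curve; `x`, `y`, `z` stand for `t³`, `t⁴`, `t⁵`. -/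
theorem connectionExpr_monomial_relations {D : R →+ M}
    (hD : ∀ f g : R, D (f * g) = f • D g + g • D f) {e₁ e₂ : M} {x y z : R}
    (hx : x • e₁ = y • e₂) (hy : y • e₁ = z • e₂) (hz : z • e₁ = (x * x) • e₂)
    (hDx : D x = (3 * y) • e₁) (hDy : D y = (4 * z) • e₁) (hDz : D z = (5 * (x * x)) • e₁)
    (r s w : R) :
    connectionExpr D e₁ e₂ (4 * x) 3
      (r • (x, -y) + s • (y, -z) + w • (z, -(x * x))) = 0 := by
  have hDxx : D (x * x) = (6 * (x * y)) • e₁ := by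
    rw [hD, hDx, smul_smul, ← add_smul]; congr 1; ring
  have hxx : (x * x) • e₁ = (x * y) • e₂ := by rw [mul_smul, hx, smul_smul]
  have hxy : (x * y) • e₁ = (x * z) • e₂ := by rw [mul_smul, hy, smul_smul]
  have zero_x : connectionExpr D e₁ e₂ (4 * x) 3 (x, -y) = 0 := by
    simp only [connectionExpr_apply, map_neg, hDx, hDy, mul_smul 4 z, hz]
    simp only [TensorProduct.neg_tmul, ← TensorProduct.smul_tmul']
    module
  have zero_y : connectionExpr D e₁ e₂ (4 * x) 3 (y, -z) = 0 := by
    have h₁ : z • e₁ ⊗ₜ[R] e₁ = (x * y) • e₂ ⊗ₜ[R] e₂ := by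
      rw [← TensorProduct.tmul_smul, hz, TensorProduct.tmul_smul, TensorProduct.smul_tmul', hxx,
        TensorProduct.smul_tmul']
    simp only [connectionExpr_apply, map_neg, hDy, hDz, mul_smul 5 (x * x), hxx]
    simp only [TensorProduct.neg_tmul, ← TensorProduct.smul_tmul', mul_smul 4 z, mul_neg, neg_smul,
      mul_smul 3 z, h₁]
    module
  have zero_z : connectionExpr D e₁ e₂ (4 * x) 3 (z, -(x * x)) = 0 := by
    have h₁ : (x * x) • e₁ ⊗ₜ[R] e₁ = (x * z) • e₂ ⊗ₜ[R] e₂ := by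
      rw [← TensorProduct.tmul_smul, hxx, TensorProduct.tmul_smul, TensorProduct.smul_tmul', hxy,
        TensorProduct.smul_tmul']
    simp only [connectionExpr_apply, map_neg, hDz, hDxx, mul_smul 6 (x * y), hxy]
    simp only [TensorProduct.neg_tmul, ← TensorProduct.smul_tmul', mul_smul 5 (x * x), mul_neg,
      neg_smul, mul_smul 3 (x * x), h₁]
    module
  simp only [map_add, connectionExpr_smul hD, zero_x, zero_y, zero_z, neg_smul, hx, hy, hz,
    add_neg_cancel, TensorProduct.tmul_zero, smul_zero, add_zero]

end Connection

theorem wedgeMap_tmul_s10 {R M : Type} [CommRing R] [AddCommGroup M] [Module R M] (u v : M) :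
    wedgeMap R M (u ⊗ₜ[R] v) = ExteriorAlgebra.ι R u * ExteriorAlgebra.ι R v :=
  rfl

theorem wedgeMap_smul_tmul_self {R M : Type} [CommRing R] [AddCommGroup M] [Module R M]
    (r : R) (u : M) : wedgeMap R M (r • u ⊗ₜ[R] u) = 0 := by
  rw [map_smul, wedgeMap_tmul_s10, ExteriorAlgebra.ι_sq_zero, smul_zero]

section MonomialCurve

theorem MonCurve.exists_polynomial (a : MonCurve) :
    ∃ p : Polynomial ℂ, algebraMap (Polynomial ℂ) (RatFunc ℂ) p = a ∧ p.coeff 1 = 0 := by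
  obtain ⟨a, ha⟩ := a
  induction ha using Algebra.adjoin_induction with
  | mem x hx =>
    rcases hx with rfl | rfl | rfl
    · exact ⟨Polynomial.X ^ 3, by simp, by simp [Polynomial.coeff_X_pow]⟩
    · exact ⟨Polynomial.X ^ 4, by simp, by simp [Polynomial.coeff_X_pow]⟩
    · exact ⟨Polynomial.X ^ 5, by simp, by simp [Polynomial.coeff_X_pow]⟩
  | algebraMap r =>
    exact ⟨Polynomial.C r, by simp [RatFunc.algebraMap_eq_C], by simp⟩
  | add x y _ _ hx hy =>
    obtain ⟨p, hp, hp'⟩ := hx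
    obtain ⟨q, hq, hq'⟩ := hy
    exact ⟨p + q, by simp_all, by simp [hp', hq']⟩
  | mul x y _ _ hx hy =>
    obtain ⟨p, hp, hp'⟩ := hx
    obtain ⟨q, hq, hq'⟩ := hy
    exact ⟨p * q, by simp_all, by simp [Polynomial.mul_coeff_one, hp', hq']⟩

/-- An element `a` with `t·a` again in the ring has vanishing constant term. -/
theorem MonCurve.coeff_zero_eq_zero_of_X_mul_eq {a b : MonCurve}
    (h : (RatFunc.X : RatFunc ℂ) * a = b) {p : Polynomial ℂ}
    (hp : algebraMap (Polynomial ℂ) (RatFunc ℂ) p = a) : p.coeff 0 = 0 := by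
  obtain ⟨q, hq, hq'⟩ := MonCurve.exists_polynomial b
  have : Polynomial.X * p = q := by
    apply RatFunc.algebraMap_injective ℂ
    rw [map_mul, RatFunc.algebraMap_X, hp, hq, h]
  rw [← this, Polynomial.coeff_X_mul] at hq'
  exact hq'

theorem MonCurve.exists_eq_const_add (a : MonCurve) :
    ∃ (k : ℂ) (r s w : MonCurve),
      a = algebraMap ℂ MonCurve k + (r * tcube + s * tfourth + w * tfifth) := by
  obtain ⟨a, ha⟩ := a
  induction ha using Algebra.adjoin_induction with
  | mem x hx =>
    rcases hx with rfl | rfl | rfl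
    · exact ⟨0, 1, 0, 0, by simp; rfl⟩
    · exact ⟨0, 0, 1, 0, by simp; rfl⟩
    · exact ⟨0, 0, 0, 1, by simp; rfl⟩
  | algebraMap k => exact ⟨k, 0, 0, 0, by simp; rfl⟩
  | add x y hx hy hx' hy' =>
    obtain ⟨k, r, s, w, h⟩ := hx'
    obtain ⟨k', r', s', w', h'⟩ := hy'
    refine ⟨k + k', r + r', s + s', w + w', ?_⟩
    change (⟨x, hx⟩ + ⟨y, hy⟩ : MonCurve) = _
    rw [h, h', map_add]
    ring
  | mul x y hx hy hx' hy' =>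
    obtain ⟨k, r, s, w, h⟩ := hx'
    obtain ⟨k', r', s', w', h'⟩ := hy'
    refine ⟨k * k', r * ⟨y, hy⟩ + algebraMap ℂ MonCurve k * r',
      s * ⟨y, hy⟩ + algebraMap ℂ MonCurve k * s', w * ⟨y, hy⟩ + algebraMap ℂ MonCurve k * w', ?_⟩
    change (⟨x, hx⟩ * ⟨y, hy⟩ : MonCurve) = _
    rw [h, map_mul]
    linear_combination algebraMap ℂ MonCurve k * h'

theorem MonOmega.exists_smul_add_smul (m : MonOmega) :
    ∃ a b : MonCurve, a • eta1 + b • eta2 = m := by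
  obtain ⟨a, b, h⟩ := Submodule.mem_span_pair.mp m.2
  exact ⟨a, b, Subtype.ext h⟩

theorem tcube_smul_eta1 : tcube • eta1 = tfourth • eta2 := by
  apply Subtype.ext
  change (RatFunc.X : RatFunc ℂ) ^ 3 * RatFunc.X⁻¹ ^ 2 = RatFunc.X ^ 4 * RatFunc.X⁻¹ ^ 3
  have := RatFunc.X_ne_zero (K := ℂ)
  field_simp

theorem tfourth_smul_eta1 : tfourth • eta1 = tfifth • eta2 := by
  apply Subtype.ext
  change (RatFunc.X : RatFunc ℂ) ^ 4 * RatFunc.X⁻¹ ^ 2 = RatFunc.X ^ 5 * RatFunc.X⁻¹ ^ 3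
  have := RatFunc.X_ne_zero (K := ℂ)
  field_simp

theorem tfifth_smul_eta1 : tfifth • eta1 = (tcube * tcube) • eta2 := by
  apply Subtype.ext
  change (RatFunc.X : RatFunc ℂ) ^ 5 * RatFunc.X⁻¹ ^ 2 =
    (RatFunc.X ^ 3 * RatFunc.X ^ 3) * RatFunc.X⁻¹ ^ 3
  have := RatFunc.X_ne_zero (K := ℂ)
  field_simp

/-- Every relation between `η₁` and `η₂` is a combination of the three monomial ones. -/
theorem MonOmega.relation_eq {a b : MonCurve} (h : a • eta1 + b • eta2 = 0) :
    ∃ r s w : MonCurve, (a, b) =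
      r • (tcube, -tfourth) + s • (tfourth, -tfifth) + w • (tfifth, -(tcube * tcube)) := by
  have hX := RatFunc.X_ne_zero (K := ℂ)
  have hab : (RatFunc.X : RatFunc ℂ) * a = (-b : MonCurve) := by
    have h' : (a : RatFunc ℂ) * RatFunc.X⁻¹ ^ 2 + (b : RatFunc ℂ) * RatFunc.X⁻¹ ^ 3 = 0 :=
      congrArg Subtype.val h
    field_simp at h'
    push_cast
    linear_combination h'
  obtain ⟨k, r, s, w, ha⟩ := MonCurve.exists_eq_const_add a
  obtain ⟨r', hr, -⟩ := MonCurve.exists_polynomial r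
  obtain ⟨s', hs, -⟩ := MonCurve.exists_polynomial s
  obtain ⟨w', hw, -⟩ := MonCurve.exists_polynomial w
  have hk : k = 0 := by
    have := MonCurve.coeff_zero_eq_zero_of_X_mul_eq hab
      (p := Polynomial.C k + (r' * Polynomial.X ^ 3 + s' * Polynomial.X ^ 4 +
        w' * Polynomial.X ^ 5)) (by
          rw [ha]
          simp only [map_add, map_mul, map_pow, RatFunc.algebraMap_X, hr, hs, hw,
            RatFunc.algebraMap_C]
          rfl)
    simpa [Polynomial.coeff_zero_eq_eval_zero] using this
  rw [hk, map_zero, zero_add] at ha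
  refine ⟨r, s, w, Prod.ext ha ?_⟩
  have hb : b = -(r * tfourth + s * tfifth + w * (tcube * tcube)) := by
    rw [eq_neg_iff_add_eq_zero, ← neg_eq_iff_add_eq_zero]
    apply Subtype.ext
    rw [← hab, ha]
    change (RatFunc.X : RatFunc ℂ) *
      ((r : RatFunc ℂ) * RatFunc.X ^ 3 + (s : RatFunc ℂ) * RatFunc.X ^ 4 +
        (w : RatFunc ℂ) * RatFunc.X ^ 5) =
      (r : RatFunc ℂ) * RatFunc.X ^ 4 + (s : RatFunc ℂ) * RatFunc.X ^ 5 +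
        (w : RatFunc ℂ) * (RatFunc.X ^ 3 * RatFunc.X ^ 3)
    ring
  rw [hb]
  change _ = r * -tfourth + s * -tfifth + w * -(tcube * tcube)
  ring

/-- Any derivation sending the ring generators into `A·η₁` takes all its values there. -/
theorem MonCurve.exists_derivation_eq_smul_eta1 {D : MonCurve →+ MonOmega}
    (hD : ∀ f g : MonCurve, D (f * g) = f • D g + g • D f)
    (hconst : ∀ c : ℂ, D (algebraMap ℂ MonCurve c) = 0)
    (h3 : ∃ c : MonCurve, D tcube = c • eta1) (h4 : ∃ c : MonCurve, D tfourth = c • eta1)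
    (h5 : ∃ c : MonCurve, D tfifth = c • eta1) (a : MonCurve) :
    ∃ c : MonCurve, D a = c • eta1 := by
  obtain ⟨a, ha⟩ := a
  induction ha using Algebra.adjoin_induction with
  | mem x hx => rcases hx with rfl | rfl | rfl <;> assumption
  | algebraMap k => exact ⟨0, (hconst k).trans (zero_smul _ _).symm⟩
  | add x y hx hy hx' hy' =>
    obtain ⟨c, h⟩ := hx'
    obtain ⟨c', h'⟩ := hy'
    refine ⟨c + c', ?_⟩
    rw [add_smul, ← h, ← h', ← map_add]
    rfl
  | mul x y hx hy hx' hy' =>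
    obtain ⟨c, h⟩ := hx'
    obtain ⟨c', h'⟩ := hy'
    refine ⟨(⟨x, hx⟩ : MonCurve) * c' + (⟨y, hy⟩ : MonCurve) * c, ?_⟩
    rw [add_smul, mul_smul, mul_smul, ← h, ← h', ← hD]
    rfl

theorem MonOmega.not_cyclic (g : MonOmega) : ¬ ∀ m : MonOmega, ∃ a : MonCurve, a • g = m := by
  intro hg
  have hX := RatFunc.X_ne_zero (K := ℂ)
  obtain ⟨a, ha⟩ := hg eta1
  obtain ⟨b, hb⟩ := hg eta2
  obtain ⟨c, d, hcd⟩ := MonOmega.exists_smul_add_smul g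
  have ha' : (a : RatFunc ℂ) * (g : RatFunc ℂ) = RatFunc.X⁻¹ ^ 2 := congrArg Subtype.val ha
  have hb' : (b : RatFunc ℂ) * (g : RatFunc ℂ) = RatFunc.X⁻¹ ^ 3 := congrArg Subtype.val hb
  have hcd' : (c : RatFunc ℂ) * RatFunc.X⁻¹ ^ 2 + (d : RatFunc ℂ) * RatFunc.X⁻¹ ^ 3 = (g : RatFunc ℂ) :=
    congrArg Subtype.val hcd
  have hg0 : (g : RatFunc ℂ) ≠ 0 := by
    intro h
    rw [h, mul_zero] at ha'
    exact pow_ne_zero 2 (inv_ne_zero hX) ha'.symm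
  have hab : (RatFunc.X : RatFunc ℂ) * b = a := by
    apply mul_right_cancel₀ hg0
    rw [mul_assoc, hb', ha']
    field_simp
  have hone : (c : RatFunc ℂ) * (RatFunc.X * (b : RatFunc ℂ)) + (d : RatFunc ℂ) * (b : RatFunc ℂ) = 1 := by
    apply mul_right_cancel₀ hg0
    rw [hab, one_mul]
    linear_combination (c : RatFunc ℂ) * ha' + (d : RatFunc ℂ) * hb' + hcd'
  obtain ⟨b', hb, -⟩ := MonCurve.exists_polynomial b
  obtain ⟨c', hc, -⟩ := MonCurve.exists_polynomial c
  obtain ⟨d', hd, -⟩ := MonCurve.exists_polynomial d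
  have hb0 := MonCurve.coeff_zero_eq_zero_of_X_mul_eq hab hb
  have hpoly : c' * (Polynomial.X * b') + d' * b' = 1 := by
    apply RatFunc.algebraMap_injective ℂ
    simpa only [map_add, map_mul, map_one, RatFunc.algebraMap_X, hb, hc, hd] using hone
  simpa [Polynomial.mul_coeff_zero, hb0] using congrArg (Polynomial.coeff · 0) hpoly

theorem MonOmega.exists_smul_eq_smul (u v : MonOmega) :
    ∃ a b : MonCurve, (a ≠ 0 ∨ b ≠ 0) ∧ a • u = b • v := by
  have hX := RatFunc.X_ne_zero (K := ℂ)
  have key : ∀ m : MonOmega, ∃ c : MonCurve,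
      (c : RatFunc ℂ) = RatFunc.X ^ 6 * (m : RatFunc ℂ) := fun m => by
    obtain ⟨a, b, rfl⟩ := MonOmega.exists_smul_add_smul m
    refine ⟨a * tfourth + b * tcube, ?_⟩
    change (a : RatFunc ℂ) * RatFunc.X ^ 4 + (b : RatFunc ℂ) * RatFunc.X ^ 3 =
      RatFunc.X ^ 6 * ((a : RatFunc ℂ) * RatFunc.X⁻¹ ^ 2 + (b : RatFunc ℂ) * RatFunc.X⁻¹ ^ 3)
    field_simp
  obtain ⟨c, hc⟩ := key u
  obtain ⟨d, hd⟩ := key v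
  by_cases h : c = 0
  · have hu : (u : RatFunc ℂ) = 0 := by
      rw [h] at hc
      exact (mul_eq_zero.mp hc.symm).resolve_left (pow_ne_zero 6 hX)
    refine ⟨1, 0, Or.inl one_ne_zero, ?_⟩
    rw [one_smul, zero_smul]
    exact Subtype.ext hu
  · refine ⟨d, c, Or.inr h, Subtype.ext ?_⟩
    change (d : RatFunc ℂ) * (u : RatFunc ℂ) = (c : RatFunc ℂ) * (v : RatFunc ℂ)
    rw [hc, hd]
    ring

theorem MonOmega.not_free : ¬ Module.Free MonCurve MonOmega := by
  intro _
  let B := Module.Free.chooseBasis MonCurve MonOmega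
  have hsub : Subsingleton (Module.Free.ChooseBasisIndex MonCurve MonOmega) := by
    refine ⟨fun i j => ?_⟩
    by_contra hij
    obtain ⟨a, b, hne, h⟩ := MonOmega.exists_smul_eq_smul (B i) (B j)
    have h' := congrArg B.repr h
    simp only [map_smul, Module.Basis.repr_self, Finsupp.smul_single, smul_eq_mul, mul_one] at h'
    have hi := DFunLike.congr_fun h' i
    have hj := DFunLike.congr_fun h' j
    simp only [Finsupp.single_eq_same, Finsupp.single_apply, hij, Ne.symm hij, if_false] at hi hj
    rcases hne with hne | hne
    · exact hne (by simpa using hi)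
    · exact hne (by simpa using hj.symm)
  rcases isEmpty_or_nonempty (Module.Free.ChooseBasisIndex MonCurve MonOmega) with he | ⟨⟨i⟩⟩
  · refine MonOmega.not_cyclic 0 fun m => ⟨0, B.repr.injective (Subsingleton.elim _ _)⟩
  · refine MonOmega.not_cyclic (B i) fun m => ⟨B.repr m i, ?_⟩
    apply B.repr.injective
    ext j
    rw [Subsingleton.elim j i]
    simp

end MonomialCurve

/-- For `A = ℂ[t³,t⁴,t⁵]`, its dualizing module `ω` generated by
`η₁ = dt/t²`, `η₂ = dt/t³`, and the canonical derivation `D(f) = f'(t) dt`, the formula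
`γ(a η₁ + b η₂) = D(a)⊗η₁ + D(b)⊗η₂ + 4t³a·η₂⊗η₂ + 3b·η₁⊗η₁` is a well-defined flat
`D`-connection; hence `D` is integrable even though `ω` is not a free module. -/
theorem monomial_curve_flat_connection
    (D : MonCurve → MonOmega)
    (Dadd : ∀ f g : MonCurve, D (f + g) = D f + D g)
    (Dleib : ∀ f g : MonCurve, D (f * g) = f • D g + g • D f)
    (Dconst : ∀ c : ℂ, D (algebraMap ℂ MonCurve c) = 0)
    (D3 : (D tcube : RatFunc ℂ) = 3 * RatFunc.X ^ 2)
    (D4 : (D tfourth : RatFunc ℂ) = 4 * RatFunc.X ^ 3)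
    (D5 : (D tfifth : RatFunc ℂ) = 5 * RatFunc.X ^ 4) :
    (∃ γ : MonOmega →+ (MonOmega ⊗[MonCurve] MonOmega),
      (∀ a b : MonCurve,
        γ (a • eta1 + b • eta2)
          = D a ⊗ₜ[MonCurve] eta1 + D b ⊗ₜ[MonCurve] eta2
            + (4 * tcube * a) • eta2 ⊗ₜ[MonCurve] eta2
            + (3 * b) • eta1 ⊗ₜ[MonCurve] eta1)
      ∧ (∀ (a : MonCurve) (m : MonOmega),
          γ (a • m) = D a ⊗ₜ[MonCurve] m + a • γ m)
      ∧ (∀ a : MonCurve, wedgeMap MonCurve MonOmega (γ (D a)) = 0))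
    ∧ ¬ Module.Free MonCurve MonOmega := by
  let D' : MonCurve →+ MonOmega := AddMonoidHom.mk' D Dadd
  have hX := RatFunc.X_ne_zero (K := ℂ)
  have h3 : D' tcube = (3 * tfourth) • eta1 := by
    apply Subtype.ext
    change (D tcube : RatFunc ℂ) = (3 * RatFunc.X ^ 4) * RatFunc.X⁻¹ ^ 2
    rw [D3]
    field_simp
  have h4 : D' tfourth = (4 * tfifth) • eta1 := by
    apply Subtype.ext
    change (D tfourth : RatFunc ℂ) = (4 * RatFunc.X ^ 5) * RatFunc.X⁻¹ ^ 2
    rw [D4]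
    field_simp
  have h5 : D' tfifth = (5 * (tcube * tcube)) • eta1 := by
    apply Subtype.ext
    change (D tfifth : RatFunc ℂ) = (5 * (RatFunc.X ^ 3 * RatFunc.X ^ 3)) * RatFunc.X⁻¹ ^ 2
    rw [D5]
    field_simp
  have hDa := MonCurve.exists_derivation_eq_smul_eta1 (D := D') Dleib Dconst ⟨_, h3⟩ ⟨_, h4⟩
    ⟨_, h5⟩
  obtain ⟨γ, hγ, hleib⟩ := exists_connection_of_relations (D := D') Dleib
    MonOmega.exists_smul_add_smul (4 * tcube) 3 fun u hu => by
      obtain ⟨r, s, w, h⟩ := MonOmega.relation_eq hu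
      rw [show u = (u.1, u.2) from rfl, h]
      exact connectionExpr_monomial_relations Dleib tcube_smul_eta1 tfourth_smul_eta1
        tfifth_smul_eta1 h3 h4 h5 r s w
  refine ⟨⟨γ, fun a b => hγ (a, b), hleib, fun a => ?_⟩, MonOmega.not_free⟩
  obtain ⟨c, hc⟩ := hDa a
  obtain ⟨e, he⟩ := hDa c
  have hγDa : γ (D a) = e • eta1 ⊗ₜ[MonCurve] eta1 +
      (4 * tcube * c) • eta2 ⊗ₜ[MonCurve] eta2 := by
    have h := hγ (c, 0)
    simp only [connectionExpr_apply, zero_smul, add_zero, map_zero, TensorProduct.zero_tmul,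
      mul_zero, he, ← TensorProduct.smul_tmul'] at h
    rw [← h, ← hc]
    rfl
  rw [hγDa, map_add, wedgeMap_smul_tmul_self, wedgeMap_smul_tmul_self, add_zero]

end
end
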